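/- The computer-verified non-turning condition for the flat-at-infinity Muskat problem holds: ∫_0^∞ z₁'(η) · z₁(η) · z₂(η) / (z₁(η)² + z₂(η)²)² dη > 0. (Since ∂_α z₂(0⁺) = 1 > 0, this gives A_flat > 0, i.e. the solution of the flat-at-infinity Muskat problem with this initial interface remains a graph for short time.) -/

import Mathlib

open MeasureTheory Real

/-- The first component of the initial interface: `z₁(α) = α - sin(α) e^{-Bα²}`, `B = 10⁻⁴`. -/
noncomputable def z₁ (α : ℝ) : ℝ := α - Real.sin α * Real.exp (-(1 / 10000) * α ^ 2)

/-- The second component of the initial interface (for `α ≥ 0`). -/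
noncomputable def z₂ (α : ℝ) : ℝ :=
  if α ≤ π / 3 then Real.sin (3 * α) / 3
  else if α ≤ π / 2 then -α + π / 3
  else if α ≤ 2 * π / 3 then α - 2 * π / 3
  else 0

namespace FlatMuskat

/-! ### Polynomials as lists of rational coefficients -/

/-- Evaluation of a list of coefficients at a real point. -/
noncomputable def ev : List ℚ → ℝ → ℝ
  | [], _ => 0
  | a :: l, x => (a : ℝ) + x * ev l x

/-- Evaluation at a rational point. -/
def evQ : List ℚ → ℚ → ℚ
  | [], _ => 0
  | a :: l, x => a + x * evQ l x

def pAdd : List ℚ → List ℚ → List ℚ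
  | [], q => q
  | a :: p, [] => a :: p
  | a :: p, b :: q => (a + b) :: pAdd p q

def pSc (c : ℚ) : List ℚ → List ℚ
  | [] => []
  | a :: p => (c * a) :: pSc c p

def pMul : List ℚ → List ℚ → List ℚ
  | [], _ => []
  | a :: p, q => pAdd (pSc a q) (0 :: pMul p q)

def pSub (p q : List ℚ) : List ℚ := pAdd p (pSc (-1) q)

def nrm : List ℚ → ℚ
  | [] => 0
  | a :: l => |a| + nrm l

/-- The composition `t ↦ l (r t)`, times `p`. -/
def scl (r : ℚ) : ℚ → List ℚ → List ℚ
  | _, [] => []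
  | p, a :: l => (p * a) :: scl r (p * r) l

/-- Antiderivative, divided by `x ^ (n + 1)`, of `x ^ n * l x`. -/
def anti : ℕ → List ℚ → List ℚ
  | _, [] => []
  | n, a :: l => (a / ((n : ℚ) + 1)) :: anti (n + 1) l

lemma ev_evQ (l : List ℚ) (q : ℚ) : ev l (q : ℝ) = (evQ l q : ℝ) := by
  induction l with
  | nil => simp [ev, evQ]
  | cons a l ih => simp [ev, evQ, ih]

lemma ev_pAdd (p q : List ℚ) (x : ℝ) : ev (pAdd p q) x = ev p x + ev q x := by
  induction p generalizing q with
  | nil => simp [ev, pAdd]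
  | cons a p ih =>
    cases q with
    | nil => simp [ev, pAdd]
    | cons b q => simp only [ev, pAdd, ih]; push_cast; ring

lemma ev_pSc (c : ℚ) (p : List ℚ) (x : ℝ) : ev (pSc c p) x = c * ev p x := by
  induction p with
  | nil => simp [ev, pSc]
  | cons a p ih => simp only [ev, pSc, ih]; push_cast; ring

lemma ev_pMul (p q : List ℚ) (x : ℝ) : ev (pMul p q) x = ev p x * ev q x := by
  induction p with
  | nil => simp [ev, pMul]
  | cons a p ih => simp only [ev, pMul, ih, ev_pAdd, ev_pSc]; push_cast; ring

lemma ev_pSub (p q : List ℚ) (x : ℝ) : ev (pSub p q) x = ev p x - ev q x := by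
  simp only [pSub, ev_pAdd, ev_pSc]; push_cast; ring

lemma abs_ev_le (l : List ℚ) (x : ℝ) (hx : |x| ≤ 1) : |ev l x| ≤ (nrm l : ℝ) := by
  induction l with
  | nil => simp [ev, nrm]
  | cons a l ih =>
    simp only [ev, nrm]
    push_cast
    refine (abs_add_le _ _).trans ?_
    rw [abs_mul]
    have := mul_le_mul hx ih (abs_nonneg _) zero_le_one
    linarith

lemma ev_scl (r p : ℚ) (l : List ℚ) (x : ℝ) : ev (scl r p l) x = p * ev l (r * x) := by
  induction l generalizing p with
  | nil => simp [ev, scl]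
  | cons a l ih => simp only [ev, scl, ih]; push_cast; ring

lemma abs_ev_le_scl (l : List ℚ) (r : ℚ) (hr : 0 < r) (x : ℝ) (hx : |x| ≤ r) :
    |ev l x| ≤ (nrm (scl r 1 l) : ℝ) := by
  have hr' : (0 : ℝ) < r := by exact_mod_cast hr
  have h := abs_ev_le (scl r 1 l) (x / r) (by
    rw [abs_div, abs_of_pos hr', div_le_one hr']; exact hx)
  rw [ev_scl, mul_div_cancel₀ _ hr'.ne'] at h
  simpa using h

lemma hasDerivAt_anti (l : List ℚ) (n : ℕ) (x : ℝ) :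
    HasDerivAt (fun x : ℝ => x ^ (n + 1) * ev (anti n l) x) (x ^ n * ev l x) x := by
  induction l generalizing n with
  | nil => simpa [ev, anti] using hasDerivAt_const x (0 : ℝ)
  | cons a l ih =>
    have h1 := ih (n + 1)
    have h2 : HasDerivAt (fun x : ℝ => (a : ℝ) / (n + 1) * x ^ (n + 1)) (a * x ^ n) x := by
      have h := (hasDerivAt_pow (n + 1) x).const_mul ((a : ℝ) / (n + 1))
      refine h.congr_deriv ?_
      have : ((n : ℝ) + 1) ≠ 0 := by positivity
      rw [Nat.add_sub_cancel]
      push_cast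
      field_simp
    have h3 := h2.add h1
    have h4 : (fun x : ℝ => x ^ (n + 1) * ev (anti n (a :: l)) x) =
        (fun x : ℝ => (a : ℝ) / (n + 1) * x ^ (n + 1)) +
          fun x : ℝ => x ^ (n + 1 + 1) * ev (anti (n + 1) l) x := by
      funext y
      simp only [ev, anti, Pi.add_apply]
      push_cast
      ring
    rw [h4]
    refine h3.congr_deriv ?_
    simp only [ev]; ring

lemma continuous_ev (l : List ℚ) : Continuous (ev l) := by
  induction l with
  | nil => simpa [ev] using continuous_const
  | cons a l ih =>
    have : ev (a :: l) = fun x => (a : ℝ) + x * ev l x := by funext x; simp [ev]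
    rw [this]
    fun_prop

def cellVal (a b : ℚ) (P : List ℚ) : ℚ :=
  (b - a) / 2 * (evQ (anti 0 P) 1 + evQ (anti 0 P) (-1))

lemma integral_cell (a b : ℚ) (hab : a < b) (P : List ℚ) :
    ∫ x in (a : ℝ)..b, ev P ((x - ((a + b) / 2 : ℚ)) / ((b - a) / 2 : ℚ)) = cellVal a b P := by
  have hr : (0 : ℝ) < (b : ℝ) - a := by
    have : (a : ℝ) < b := by exact_mod_cast hab
    linarith
  set c : ℝ := (((a + b) / 2 : ℚ) : ℝ) with hc
  set r : ℝ := (((b - a) / 2 : ℚ) : ℝ) with hrr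
  have hc' : c = ((a : ℝ) + b) / 2 := by rw [hc]; push_cast; ring
  have hr' : r = ((b : ℝ) - a) / 2 := by rw [hrr]; push_cast; ring
  have hr0 : r ≠ 0 := by rw [hr']; positivity
  have hd : ∀ x ∈ Set.uIcc (a : ℝ) b, HasDerivAt
      (fun x : ℝ => r * (((x - c) / r) ^ (0 + 1) * ev (anti 0 P) ((x - c) / r)))
      (ev P ((x - c) / r)) x := by
    intro x _
    have h1 := hasDerivAt_anti P 0 ((x - c) / r)
    have h2 : HasDerivAt (fun x : ℝ => (x - c) / r) (1 / r) x :=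
      ((hasDerivAt_id x).sub_const c).div_const r
    have h3 := (h1.comp x h2).const_mul r
    refine h3.congr_deriv ?_
    rw [pow_zero, one_mul]
    field_simp
  rw [intervalIntegral.integral_eq_sub_of_hasDerivAt hd]
  · have e1 : ((b : ℝ) - c) / r = ((1 : ℚ) : ℝ) := by
      rw [hc', hr']; push_cast; field_simp; ring
    have e2 : ((a : ℝ) - c) / r = ((-1 : ℚ) : ℝ) := by
      rw [hc', hr']; push_cast; field_simp; ring
    rw [e1, e2, ev_evQ, ev_evQ, cellVal, hr']
    push_cast
    ring
  · apply Continuous.intervalIntegrable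
    have := continuous_ev P
    fun_prop

/-! ### Polynomials with integer coefficients -/

noncomputable def evZ : List ℤ → ℝ → ℝ
  | [], _ => 0
  | a :: l, x => (a : ℝ) + x * evZ l x

def zAdd : List ℤ → List ℤ → List ℤ
  | [], q => q
  | a :: p, [] => a :: p
  | a :: p, b :: q => (a + b) :: zAdd p q

def zSc (c : ℤ) : List ℤ → List ℤ
  | [] => []
  | a :: p => (c * a) :: zSc c p

def zMul : List ℤ → List ℤ → List ℤ
  | [], _ => []
  | a :: p, q => zAdd (zSc a q) (0 :: zMul p q)

def zSub (p q : List ℤ) : List ℤ := zAdd p (zSc (-1) q)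

/-- `(u + v t) l(t) + k t`. -/
def zLin (u v : ℤ) : ℤ → List ℤ → List ℤ
  | k, [] => [k]
  | k, a :: l => (u * a + k) :: zLin u v (v * a) l

/-- Powers of `w`. -/
def wPow (w : ℤ) : List ℤ → ℤ
  | [] => 1
  | _ :: l => w * wPow w l

/-- The composition `t ↦ l ((u + v t) / w)`, multiplied by `wPow w l`. -/
def zShift (u v w : ℤ) : List ℤ → List ℤ
  | [] => []
  | a :: l => zLin u v (a * (w * wPow w l)) (zShift u v w l)

def zNrm : List ℤ → ℤ
  | [] => 0
  | a :: l => (a.natAbs : ℤ) + zNrm l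

/-- Lower bound of a polynomial on `[-1, 1]`. -/
def zLow : List ℤ → ℤ
  | [] => 0
  | a :: l => a - zNrm l

/-- Division of coefficients by `m`, rounded down, and truncation. -/
def zRnd (m : ℤ) (l : List ℤ) : List ℤ := (l.take 11).map fun q => q / m

def toQ (d : ℚ) : List ℤ → List ℚ
  | [] => []
  | a :: l => ((a : ℚ) / d) :: toQ d l

lemma ev_toQ (d : ℚ) (l : List ℤ) (x : ℝ) : ev (toQ d l) x = evZ l x / d := by
  induction l with
  | nil => simp [ev, evZ, toQ]
  | cons a l ih => simp only [ev, evZ, toQ, ih]; push_cast; ring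

lemma evZ_zAdd (p q : List ℤ) (x : ℝ) : evZ (zAdd p q) x = evZ p x + evZ q x := by
  induction p generalizing q with
  | nil => simp [evZ, zAdd]
  | cons a p ih =>
    cases q with
    | nil => simp [evZ, zAdd]
    | cons b q => simp only [evZ, zAdd, ih]; push_cast; ring

lemma evZ_zSc (c : ℤ) (p : List ℤ) (x : ℝ) : evZ (zSc c p) x = c * evZ p x := by
  induction p with
  | nil => simp [evZ, zSc]
  | cons a p ih => simp only [evZ, zSc, ih]; push_cast; ring

lemma evZ_zMul (p q : List ℤ) (x : ℝ) : evZ (zMul p q) x = evZ p x * evZ q x := by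
  induction p with
  | nil => simp [evZ, zMul]
  | cons a p ih => simp only [evZ, zMul, ih, evZ_zAdd, evZ_zSc]; push_cast; ring

lemma evZ_zSub (p q : List ℤ) (x : ℝ) : evZ (zSub p q) x = evZ p x - evZ q x := by
  simp only [zSub, evZ_zAdd, evZ_zSc]; push_cast; ring

lemma evZ_zLin (u v k : ℤ) (l : List ℤ) (x : ℝ) :
    evZ (zLin u v k l) x = (u + v * x) * evZ l x + k := by
  induction l generalizing k with
  | nil => simp [evZ, zLin]
  | cons a l ih => simp only [evZ, zLin, ih]; push_cast; ring

lemma evZ_zShift (u v w : ℤ) (hw : (w : ℝ) ≠ 0) (l : List ℤ) (x : ℝ) :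
    evZ (zShift u v w l) x = wPow w l * evZ l ((u + v * x) / w) := by
  induction l with
  | nil => simp [evZ, zShift]
  | cons a l ih =>
    simp only [evZ, zShift, wPow, ih, evZ_zLin]
    push_cast
    field_simp
    ring

lemma wPow_pos (w : ℤ) (hw : 0 < w) (l : List ℤ) : 0 < wPow w l := by
  induction l with
  | nil => simp [wPow]
  | cons a l ih => simp only [wPow]; positivity

lemma abs_evZ_le (l : List ℤ) (x : ℝ) (hx : |x| ≤ 1) : |evZ l x| ≤ (zNrm l : ℝ) := by
  induction l with
  | nil => simp [evZ, zNrm]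
  | cons a l ih =>
    simp only [evZ, zNrm]
    push_cast
    refine (abs_add_le _ _).trans ?_
    rw [abs_mul]
    have := mul_le_mul hx ih (abs_nonneg _) zero_le_one
    have h2 : ((a.natAbs : ℕ) : ℝ) = |(a : ℝ)| := by
      rw [Nat.cast_natAbs]; push_cast; rfl
    linarith

lemma zLow_le_evZ (l : List ℤ) (x : ℝ) (hx : |x| ≤ 1) : (zLow l : ℝ) ≤ evZ l x := by
  cases l with
  | nil => simp [evZ, zLow]
  | cons a l =>
    simp only [evZ, zLow]
    push_cast
    have h1 := abs_evZ_le l x hx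
    have h2 : |x * evZ l x| ≤ zNrm l := by
      rw [abs_mul]
      have := mul_le_mul hx h1 (abs_nonneg _) zero_le_one
      linarith
    have := neg_abs_le (x * evZ l x)
    linarith

/-! ### The integrand -/

noncomputable def F (x : ℝ) : ℝ := deriv z₁ x * z₁ x * z₂ x / (z₁ x ^ 2 + z₂ x ^ 2) ^ 2

lemma key_bound (a b c a' b' c' p : ℝ) (ha : |a - a'| ≤ 1 / 10 ^ 11) (hb : |b - b'| ≤ 1 / 10 ^ 11)
    (hc : |c - c'| ≤ 1 / 10 ^ 11) (ha' : |a'| ≤ 2) (hb' : |b'| ≤ 2) (hc' : |c'| ≤ 2)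
    (hp : |p| ≤ 16) (h : 1 / 10 ^ 7 ≤ a' * b' * c' - p * (a' ^ 2 + c' ^ 2) ^ 2) (h0 : 0 < a) :
    p ≤ b * a * c / (a ^ 2 + c ^ 2) ^ 2 := by
  have hD : 0 < (a ^ 2 + c ^ 2) ^ 2 := by positivity
  rw [le_div_iff₀ hD]
  have aux : ∀ u v : ℝ, |u - v| ≤ 1 / 10 ^ 11 → |v| ≤ 2 → |u| ≤ 3 := by
    intro u v h1 h2
    rw [abs_le] at *
    constructor <;> linarith [h1.1, h1.2, h2.1, h2.2]
  have ha3 := aux a a' ha ha'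
  have hb3 := aux b b' hb hb'
  have hc3 := aux c c' hc hc'
  have m : ∀ {u v U V : ℝ}, |u| ≤ U → |v| ≤ V → |u * v| ≤ U * V := by
    intro u v U V h1 h2
    rw [abs_mul]
    exact mul_le_mul h1 h2 (abs_nonneg _) ((abs_nonneg _).trans h1)
  have s : ∀ {u v U V : ℝ}, |u| ≤ U → |v| ≤ V → |u + v| ≤ U + V := by
    intro u v U V h1 h2
    exact (abs_add_le _ _).trans (add_le_add h1 h2)
  have t1 := s (s (m (m ha hb3) hc3) (m (m ha' hb) hc3)) (m (m ha' hb') hc)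
  have t2 := s (m ha (s ha3 ha')) (m hc (s hc3 hc'))
  have t3 := s (s (m ha3 ha3) (m hc3 hc3)) (s (m ha' ha') (m hc' hc'))
  have t4 := m hp (m t2 t3)
  rw [abs_le] at t1 t4
  obtain ⟨t1, -⟩ := t1
  obtain ⟨-, t4⟩ := t4
  have e1 : (a - a') * b * c + a' * (b - b') * c + a' * b' * (c - c') =
    b * a * c - a' * b' * c' := by ring
  have e2 : p * (((a - a') * (a + a') + (c - c') * (c + c')) *
    (a * a + c * c + (a' * a' + c' * c'))) =
    p * (a ^ 2 + c ^ 2) ^ 2 - p * (a' ^ 2 + c' ^ 2) ^ 2 := by ring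
  rw [e1] at t1
  rw [e2] at t4
  norm_num at t1 t4 h
  linarith

/-- The check carried out on one cell `[a / 10 ^ 12, b / 10 ^ 12]`. -/
def cellOK (A B C : List ℤ) (a b : ℤ) (P : List ℤ) : Bool :=
  let A0 := zShift (a + b) (b - a) 2000000000000 A
  let B0 := zShift (a + b) (b - a) 2000000000000 B
  let C0 := zShift (a + b) (b - a) 2000000000000 C
  let mA := 100000000000000000 * wPow 2000000000000 A
  let mB := 100000000000000000 * wPow 2000000000000 B
  let mC := 100000000000000000 * wPow 2000000000000 C
  let A1 := zRnd mA A0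
  let B1 := zRnd mB B0
  let C1 := zRnd mC C0
  let R := zAdd (zMul A1 A1) (zMul C1 C1)
  decide (a < b) &&
  decide (zNrm (zSub A0 (zSc mA A1)) ≤ 20 * mA) &&
  decide (zNrm (zSub B0 (zSc mB B1)) ≤ 20 * mB) &&
  decide (zNrm (zSub C0 (zSc mC C1)) ≤ 20 * mC) &&
  decide (zNrm A1 ≤ 20000000000000) && decide (zNrm B1 ≤ 20000000000000) &&
  decide (zNrm C1 ≤ 20000000000000) && decide (zNrm P ≤ 1600000) &&
  decide (100000000000000000000000000000000000000000000000000 ≤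
    zLow (zSub (zSc 1000000000000000000 (zMul (zMul A1 B1) C1)) (zMul P (zMul R R))))

/-- Fixed-point endpoints. -/
def qe (a : ℤ) : ℚ := (a : ℚ) / 1000000000000

lemma qe_real (a : ℤ) : ((qe a : ℚ) : ℝ) = (a : ℝ) / 1000000000000 := by
  simp [qe]

lemma qe_lt {a b : ℤ} (h : a < b) : qe a < qe b := by
  unfold qe
  have : (a : ℚ) < b := by exact_mod_cast h
  gcongr

lemma cell_le (A B C : List ℤ) (a b : ℤ) (P : List ℤ) (h : cellOK A B C a b P = true) (x : ℝ)
    (hx : x ∈ Set.Icc ((qe a : ℚ) : ℝ) (qe b : ℚ)) (hz : 0 < z₁ x)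
    (hA : |z₁ x - evZ A x / 10 ^ 30| ≤ 8 / 10 ^ 12)
    (hB : |deriv z₁ x - evZ B x / 10 ^ 30| ≤ 8 / 10 ^ 12)
    (hC : |z₂ x - evZ C x / 10 ^ 30| ≤ 8 / 10 ^ 12) :
    ev (toQ 100000 P) ((x - ((qe a + qe b) / 2 : ℚ)) / ((qe b - qe a) / 2 : ℚ)) ≤ F x := by
  simp only [cellOK, Bool.and_eq_true, decide_eq_true_eq] at h
  obtain ⟨⟨⟨⟨⟨⟨⟨⟨hab, eA⟩, eB⟩, eC⟩, nA⟩, nB⟩, nC⟩, nP⟩, hl⟩ := h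
  have hr : (0 : ℝ) < (b : ℝ) - a := by
    have : (a : ℝ) < b := by exact_mod_cast hab
    linarith
  have hc' : (((qe a + qe b) / 2 : ℚ) : ℝ) = ((a : ℝ) + b) / 2000000000000 := by
    push_cast; rw [qe_real, qe_real]; ring
  have hr' : (((qe b - qe a) / 2 : ℚ) : ℝ) = ((b : ℝ) - a) / 2000000000000 := by
    push_cast; rw [qe_real, qe_real]; ring
  rw [hc', hr']
  rw [qe_real, qe_real] at hx
  have hr0 : (0 : ℝ) < ((b : ℝ) - a) / 2000000000000 := by positivity
  set t : ℝ := (x - ((a : ℝ) + b) / 2000000000000) / (((b : ℝ) - a) / 2000000000000) with ht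
  have hxt : (((a + b : ℤ) : ℝ) + ((b - a : ℤ) : ℝ) * t) / ((2000000000000 : ℤ) : ℝ) = x := by
    rw [ht]; push_cast; field_simp; ring
  have ht1 : |t| ≤ 1 := by
    rw [ht, abs_div, abs_of_pos hr0, div_le_one hr0, abs_le]
    constructor <;> linarith [hx.1, hx.2]
  have comb : ∀ (z : ℝ) (L L' : List ℤ), |z - evZ L x / 10 ^ 30| ≤ 8 / 10 ^ 12 →
      zNrm (zSub (zShift (a + b) (b - a) 2000000000000 L)
        (zSc (100000000000000000 * wPow 2000000000000 L) L')) ≤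
        20 * (100000000000000000 * wPow 2000000000000 L) →
      |z - evZ L' t / 10 ^ 13| ≤ 1 / 10 ^ 11 := by
    intro z L L' h1 h2
    have h3 := (abs_evZ_le _ t ht1).trans (Int.cast_le (R := ℝ).2 h2)
    rw [evZ_zSub, evZ_zSc, evZ_zShift _ _ _ (by norm_num), hxt] at h3
    have hm : (0 : ℝ) < wPow 2000000000000 L := by
      exact_mod_cast wPow_pos 2000000000000 (by norm_num) L
    push_cast at h3
    generalize (wPow 2000000000000 L : ℝ) = m at h3 hm
    have e : m * evZ L x - 100000000000000000 * m * evZ L' t =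
      (m * 10 ^ 30) * (evZ L x / 10 ^ 30 - evZ L' t / 10 ^ 13) := by
      ring
    rw [e, abs_mul, abs_of_pos (by positivity : (0 : ℝ) < m * 10 ^ 30)] at h3
    have h4 : |evZ L x / 10 ^ 30 - evZ L' t / 10 ^ 13| ≤ 2 / 10 ^ 12 := by
      refine le_of_mul_le_mul_left (h3.trans (le_of_eq ?_))
        (by positivity : (0 : ℝ) < m * 10 ^ 30)
      ring
    have h5 := abs_sub_le z (evZ L x / 10 ^ 30) (evZ L' t / 10 ^ 13)
    calc _ ≤ _ := h5
      _ ≤ 8 / 10 ^ 12 + 2 / 10 ^ 12 := add_le_add h1 h4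
      _ = _ := by norm_num
  have bd : ∀ (L : List ℤ), zNrm L ≤ 20000000000000 → |evZ L t / 10 ^ 13| ≤ 2 := by
    intro L h1
    have h2 := (abs_evZ_le L t ht1).trans (Int.cast_le (R := ℝ).2 h1)
    push_cast at h2
    rw [abs_div, abs_of_pos (by positivity : (0 : ℝ) < 10 ^ 13), div_le_iff₀ (by positivity)]
    exact h2.trans (le_of_eq (by norm_num))
  have hP : |evZ P t / 100000| ≤ 16 := by
    have h2 := (abs_evZ_le P t ht1).trans (Int.cast_le (R := ℝ).2 nP)
    push_cast at h2
    rw [abs_div, abs_of_pos (by positivity : (0 : ℝ) < 100000), div_le_iff₀ (by positivity)]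
    exact h2.trans (le_of_eq (by norm_num))
  have hlow := (Int.cast_le (R := ℝ).2 hl).trans (zLow_le_evZ _ t ht1)
  simp only [evZ_zSub, evZ_zMul, evZ_zAdd, evZ_zSc] at hlow
  rw [ev_toQ]
  push_cast
  refine key_bound (z₁ x) (deriv z₁ x) (z₂ x) _ _ _ (evZ P t / 100000) (comb _ A _ hA eA)
    (comb _ B _ hB eB) (comb _ C _ hC eC) (bd _ nA) (bd _ nB) (bd _ nC) hP ?_ hz
  push_cast at hlow
  generalize evZ P t = p at *
  generalize evZ (zRnd _ (zShift _ _ _ A)) t = u at *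
  generalize evZ (zRnd _ (zShift _ _ _ B)) t = v at *
  generalize evZ (zRnd _ (zShift _ _ _ C)) t = w at *
  have e : u / 10 ^ 13 * (v / 10 ^ 13) * (w / 10 ^ 13) -
      p / 100000 * ((u / 10 ^ 13) ^ 2 + (w / 10 ^ 13) ^ 2) ^ 2 =
      (1000000000000000000 * (u * v * w) - p * ((u * u + w * w) * (u * u + w * w))) / 10 ^ 57 := by
    ring
  rw [e, le_div_iff₀ (by positivity)]
  refine le_trans (le_of_eq ?_) hlow
  norm_num

/-! ### Lists of cells -/

def runOK (A B C : List ℤ) : ℤ → List (ℤ × List ℤ) → Bool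
  | _, [] => true
  | a, (b, P) :: l => cellOK A B C a b P && runOK A B C b l

def endpt : ℤ → List (ℤ × List ℤ) → ℤ
  | a, [] => a
  | _, (b, _) :: l => endpt b l

def total : ℤ → List (ℤ × List ℤ) → ℚ
  | _, [] => 0
  | a, (b, P) :: l => cellVal (qe a) (qe b) (toQ 100000 P) + total b l

lemma cellOK_lt {A B C : List ℤ} {a b : ℤ} {P : List ℤ} (h : cellOK A B C a b P = true) :
    a < b := by
  simp only [cellOK, Bool.and_eq_true, decide_eq_true_eq] at h
  exact h.1.1.1.1.1.1.1.1

lemma le_endpt (A B C : List ℤ) (a : ℤ) (l : List (ℤ × List ℤ)) (h : runOK A B C a l = true) :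
    a ≤ endpt a l := by
  induction l generalizing a with
  | nil => simp [endpt]
  | cons d l ih =>
    obtain ⟨b, P⟩ := d
    simp only [runOK, Bool.and_eq_true] at h
    exact (cellOK_lt h.1).le.trans (ih b h.2)

lemma total_le (A B C : List ℤ) (a : ℤ) (l : List (ℤ × List ℤ)) (h : runOK A B C a l = true)
    (ha : 0 < a) (hF : ContinuousOn F (Set.Ioi 0)) (hz : ∀ x > 0, 0 < z₁ x)
    (hyp : ∀ x : ℝ, ((qe a : ℚ) : ℝ) ≤ x → x ≤ (qe (endpt a l) : ℚ) →
      |z₁ x - evZ A x / 10 ^ 30| ≤ 8 / 10 ^ 12 ∧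
      |deriv z₁ x - evZ B x / 10 ^ 30| ≤ 8 / 10 ^ 12 ∧
      |z₂ x - evZ C x / 10 ^ 30| ≤ 8 / 10 ^ 12) :
    (total a l : ℝ) ≤ ∫ x in ((qe a : ℚ) : ℝ)..(qe (endpt a l) : ℚ), F x := by
  have mono : ∀ u v : ℤ, u ≤ v → ((qe u : ℚ) : ℝ) ≤ (qe v : ℚ) := by
    intro u v huv
    rw [qe_real, qe_real]
    have : (u : ℝ) ≤ v := by exact_mod_cast huv
    gcongr
  have pos : ∀ u : ℤ, 0 < u → (0 : ℝ) < (qe u : ℚ) := by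
    intro u hu
    rw [qe_real]
    positivity
  have hint : ∀ u v : ℤ, 0 < u → u ≤ v →
      IntervalIntegrable F volume ((qe u : ℚ) : ℝ) (qe v : ℚ) := by
    intro u v hu huv
    apply ContinuousOn.intervalIntegrable
    refine hF.mono ?_
    rw [Set.uIcc_of_le (mono u v huv)]
    intro y hy
    exact lt_of_lt_of_le (pos u hu) hy.1
  induction l generalizing a with
  | nil => simp [endpt, total]
  | cons d l ih =>
    obtain ⟨b, P⟩ := d
    simp only [runOK, Bool.and_eq_true] at h
    have hab := cellOK_lt h.1
    have hb := le_endpt _ _ _ _ _ h.2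
    have hbR := mono _ _ hb
    have habR := mono _ _ hab.le
    simp only [endpt, total] at hyp ⊢
    have h1 := ih b h.2 (ha.trans hab) (fun x hx hx' => hyp x (habR.trans hx) hx')
    rw [← intervalIntegral.integral_add_adjacent_intervals (hint a b ha hab.le)
      (hint b _ (ha.trans hab) hb)]
    push_cast
    refine add_le_add ?_ h1
    rw [← integral_cell (qe a) (qe b) (qe_lt hab)]
    refine intervalIntegral.integral_mono_on habR ?_ (hint a b ha hab.le) ?_
    · apply Continuous.intervalIntegrable
      have := continuous_ev (toQ 100000 P)
      fun_prop
    · intro x hx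
      obtain ⟨h2, h3, h4⟩ := hyp x hx.1 (hx.2.trans hbR)
      exact cell_le A B C a b P h.1 x hx (hz x ((pos a ha).trans_le hx.1)) h2 h3 h4

/-! ### The data -/

def sinL : List ℚ := [0, 1/1, 0, -1/6, 0, 1/120, 0, -1/5040, 0, 1/362880, 0, -1/39916800, 0, 1/6227020800, 0, -1/1307674368000, 0, 1/355687428096000, 0, -1/121645100408832000, 0, 1/51090942171709440000, 0, -1/25852016738884976640000, 0, 1/15511210043330985984000000, 0, -1/10888869450418352160768000000]

def cosL : List ℚ := [1/1, 0, -1/2, 0, 1/24, 0, -1/720, 0, 1/40320, 0, -1/3628800, 0, 1/479001600, 0, -1/87178291200, 0, 1/20922789888000, 0, -1/6402373705728000, 0, 1/2432902008176640000, 0, -1/1124000727777607680000, 0, 1/620448401733239439360000, 0, -1/403291461126605635584000000, 0]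

def expL : List ℚ := [1, 0, -1/10000, 0, 1/200000000, 0, -1/6000000000000]

def LA : List ℚ := pSub [0, 1] (pMul sinL expL)

def LB : List ℚ := pAdd (pSub [1] (pMul cosL expL)) (pMul [0, 1/5000] (pMul sinL expL))

def LC1 : List ℚ := pSc (1/3) (scl 3 1 sinL)

/-- Fixed-point versions, with denominator `10 ^ 30`. -/
def ZA : List ℤ := [0, 0, 0, 166766666666666666666666666667, 0, -8350005000000000000000000000, 0, 199246865246031746031746032, 0, -2775614886684303350970018, 0, 25328675030062530062530, 0, -163109460935155379600, 0, 780901136849384204, 0, -2888736019206958, 0, 8505631318998, 0, -20409189327]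

def ZB : List ℤ := [0, 0, 500300000000000000000000000000, 0, -41750025000000000000000000000, 0, 1394728056722222222222222222, 0, -24980533980192063492063492, 0, 278615425336243386243386, 0, -2120422992434797712575, 0, 11713517059354519672, 0, -49108512418376010, 0, 161606995896029, 0, -428592981221, 0]

def ZC1 : List ℤ := [0, 1000000000000000000000000000000, 0, -1500000000000000000000000000000, 0, 675000000000000000000000000000, 0, -144642857142857142857142857143, 0, 18080357142857142857142857143, 0, -1479301948051948051948051948, 0, 85344343156843156843156843, 0, -3657614706721849578992436, 0, 121024016031237669893132, 0, -3184842527137833418240, 0, 68246625581525001819, 0, -1213872787023171969, 0]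

def ZC2 : List ℤ := [1047197551196000000000000000000, -1000000000000000000000000000000]

def ZC3 : List ℤ := [-2094395102394000000000000000000, 1000000000000000000000000000000]

def cells1 : List (ℤ × List ℤ) := [
  (500000000000, [2632, 2466, 1082, 349, 95, 24, 5]),
  (600000000000, [10693, 5154, 1342, 262, 42, 6, 0]),
  (700000000000, [29409, 15714, 4679, 1031, 184, 27, 3]),
  (760000000000, [72310, 25648, 5014, 692, 69, 4, -1]),
  (820000000000, [150428, 56496, 11051, 1310, 52, -19, -6]),
  (860000000000, [281397, 69354, 7479, 128, -96, -19, -2]),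
  (900000000000, [448844, 96004, 4127, -1610, -362, -29, 1]),
  (940000000000, [637984, 80009, -15527, -4865, -270, 80, 15]),
  (980000000000, [696204, -39836, -41358, -1728, 1158, 117, -22]),
  (1010000000000, [502642, -129543, -15058, 2875, 240, -49, -4]),
  (1047197551196, [172347, -185355, 8734, 4787, -621, -62, 17])]

def cells2 : List (ℤ × List ℤ) := [
  (1080000000000, [-122150, -105647, 16627, -25, -269, 30, 0]),
  (1120000000000, [-279891, -49225, 17350, -1934, -8, 35, -6]),
  (1180000000000, [-322721, 7549, 12482, -3562, 528, -29, -7]),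
  (1260000000000, [-269323, 38527, 84, -1470, 441, -86, 11]),
  (1330000000000, [-202556, 27191, -2107, 1, 33, -8, 1]),
  (1420000000000, [-150806, 23788, -2643, 205, -4, -3, 0]),
  (1570796326794, [-102497, 22604, -3751, 538, -64, 4, 0])]

def cells3 : List (ℤ × List ℤ) := [
  (1800000000000, [-75662, 18926, 9352, -2878, -571, 253, 17]),
  (1950000000000, [-32813, 16597, -1563, -313, 97, -7, -2]),
  (2094395102394, [-7418, 8822, -1673, 107, 14, -5, 0])]

def q1 : ℤ := 1047197551196
def q2 : ℤ := 1570796326794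
def q3 : ℤ := 2094395102394

lemma run1 : runOK ZA ZB ZC1 300000000000 cells1 = true := by decide +kernel
lemma run2 : runOK ZA ZB ZC2 q1 cells2 = true := by decide +kernel
lemma run3 : runOK ZA ZB ZC3 q2 cells3 = true := by decide +kernel

lemma end1 : endpt 300000000000 cells1 = q1 := by decide +kernel
lemma end2 : endpt q1 cells2 = q2 := by decide +kernel
lemma end3 : endpt q2 cells3 = q3 := by decide +kernel

lemma total_pos : 0 < total 300000000000 cells1 + total q1 cells2 + total q2 cells3 := by
  decide +kernel

lemma closeA : nrm (scl (21/10) 1 (pSub LA (toQ (10 ^ 30) ZA))) ≤ 1 / 10 ^ 12 := by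
  decide +kernel
lemma closeB : nrm (scl (21/10) 1 (pSub LB (toQ (10 ^ 30) ZB))) ≤ 1 / 10 ^ 12 := by
  decide +kernel
lemma closeC : nrm (scl (105/100) 1 (pSub LC1 (toQ (10 ^ 30) ZC1))) ≤ 1 / 10 ^ 12 := by
  decide +kernel

lemma close_of (z x : ℝ) (r : ℚ) (hr : 0 < r) (hx : |x| ≤ r) (L : List ℚ) (Z : List ℤ)
    (h : nrm (scl r 1 (pSub L (toQ (10 ^ 30) Z))) ≤ 1 / 10 ^ 12)
    (h2 : |z - ev L x| ≤ 7 / 10 ^ 12) : |z - evZ Z x / 10 ^ 30| ≤ 8 / 10 ^ 12 := by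
  have h3 := (abs_ev_le_scl _ r hr x hx).trans (Rat.cast_le (K := ℝ).2 h)
  rw [ev_pSub, ev_toQ] at h3
  push_cast at h3
  calc _ ≤ _ := abs_sub_le z (ev L x) (evZ Z x / 10 ^ 30)
    _ ≤ 7 / 10 ^ 12 + 1 / 10 ^ 12 := add_le_add h2 h3
    _ = _ := by norm_num

/-! ### Analytic facts -/

lemma z1_pos (x : ℝ) (hx : 0 < x) : 0 < z₁ x := by
  unfold z₁
  have h1 : |Real.sin x| < x := by
    have := Real.abs_sin_lt_abs hx.ne'
    rwa [abs_of_pos hx] at this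
  have h2 : Real.exp (-(1 / 10000) * x ^ 2) ≤ 1 := by
    rw [Real.exp_le_one_iff]; nlinarith [sq_nonneg x]
  have h3 := Real.exp_pos (-(1 / 10000) * x ^ 2)
  have h4 : Real.sin x * Real.exp (-(1 / 10000) * x ^ 2) ≤ |Real.sin x| := by
    refine (le_abs_self _).trans ?_
    rw [abs_mul, abs_of_pos h3]
    exact mul_le_of_le_one_right (abs_nonneg _) h2
  linarith

lemma deriv_z1 (x : ℝ) : deriv z₁ x = 1 - Real.cos x * Real.exp (-(1 / 10000) * x ^ 2) +
    1 / 5000 * x * (Real.sin x * Real.exp (-(1 / 10000) * x ^ 2)) := by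
  have h1 : HasDerivAt (fun x : ℝ => -(1 / 10000) * x ^ 2) (-(1 / 10000) * (2 * x)) x := by
    have h := (hasDerivAt_pow 2 x).const_mul (-(1 / 10000) : ℝ)
    exact h.congr_deriv (by simp)
  have h2 := (hasDerivAt_id x).sub ((Real.hasDerivAt_sin x).mul h1.exp)
  have h3 : HasDerivAt z₁ _ x := h2
  rw [h3.deriv]
  ring

lemma continuous_z2 : Continuous z₂ := by
  unfold z₂
  refine Continuous.if_le (by fun_prop) ?_ continuous_id continuous_const ?_
  · refine Continuous.if_le (by fun_prop) ?_ continuous_id continuous_const ?_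
    · refine Continuous.if_le (by fun_prop) continuous_const continuous_id continuous_const ?_
      intro x hx
      rw [hx]; ring
    · intro x hx
      have := Real.pi_pos
      rw [if_pos (by linarith), hx]; ring
  · intro x hx
    have := Real.pi_pos
    rw [if_pos (by linarith), hx, show 3 * (π / 3) = π by ring, Real.sin_pi]; ring

lemma continuousOn_F : ContinuousOn F (Set.Ioi 0) := by
  unfold F
  have h1 : Continuous (deriv z₁) := by
    have : deriv z₁ = _ := funext deriv_z1
    rw [this]; fun_prop
  have h2 : Continuous z₁ := by unfold z₁; fun_prop
  have h3 := continuous_z2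
  refine ContinuousOn.div (by fun_prop) (by fun_prop) ?_
  intro x hx
  have := z1_pos x hx
  positivity

lemma small_facts (x : ℝ) (h0 : 0 < x) (h1 : x ≤ 3 / 10) :
    0 ≤ deriv z₁ x ∧ deriv z₁ x ≤ x ^ 2 ∧ x / 2 ≤ z₂ x := by
  have hs : 0 < Real.sin x := Real.sin_pos_of_pos_of_lt_pi h0 (by linarith [Real.pi_gt_three])
  have hs2 : Real.sin x < x := Real.sin_lt h0
  have he : Real.exp (-(1 / 10000) * x ^ 2) ≤ 1 := by
    rw [Real.exp_le_one_iff]; nlinarith [sq_nonneg x]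
  have he0 := Real.exp_pos (-(1 / 10000) * x ^ 2)
  have he2 := Real.add_one_le_exp (-(1 / 10000) * x ^ 2)
  have hc := Real.one_sub_sq_div_two_le_cos (x := x)
  have hc1 := Real.cos_le_one x
  rw [deriv_z1]
  generalize Real.exp (-(1 / 10000) * x ^ 2) = e at *
  generalize hS : Real.sin x = s at *
  generalize hC : Real.cos x = c at *
  have hc0 : 0 < c := by nlinarith
  have hse : s * e ≤ x := by nlinarith
  have hse0 : 0 < s * e := by positivity
  refine ⟨?_, ?_, ?_⟩
  · have : c * e ≤ 1 := by nlinarith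
    have : 0 ≤ x * (s * e) := by positivity
    nlinarith
  · have g1 : x * (s * e) ≤ x * x := mul_le_mul_of_nonneg_left hse h0.le
    have g2 : (1 - x ^ 2 / 2) * (-(1 / 10000) * x ^ 2 + 1) ≤ c * e :=
      mul_le_mul hc he2 (by nlinarith) hc0.le
    have g3 : 0 ≤ x ^ 2 * x ^ 2 := by positivity
    nlinarith
  · unfold z₂
    rw [if_pos (by linarith [Real.pi_gt_three])]
    have := Real.sin_gt_sub_cube (x := 3 * x) (by linarith)
    nlinarith [mul_pos h0 h0, mul_nonneg h0.le (show 0 ≤ 9 / 100 - x ^ 2 by nlinarith)]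

lemma F_small (x : ℝ) (h0 : 0 < x) (h1 : x ≤ 3 / 10) : 0 ≤ F x ∧ F x ≤ 2 := by
  obtain ⟨a1, a2, a3⟩ := small_facts x h0 h1
  have hz := z1_pos x h0
  unfold F
  generalize deriv z₁ x = d at *
  generalize z₁ x = u at *
  generalize z₂ x = v at *
  have hv : 0 < v := by linarith
  refine ⟨by positivity, ?_⟩
  rw [div_le_iff₀ (by positivity)]
  have b1 : d ≤ 4 * v ^ 2 := by nlinarith
  have b2 : d * u * v ≤ 4 * v ^ 2 * u * v := by gcongr
  have b3 : 2 * (u * v) ≤ u ^ 2 + v ^ 2 := by nlinarith [sq_nonneg (u - v)]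
  have b4 : v ^ 2 ≤ u ^ 2 + v ^ 2 := by nlinarith
  have b5 : 2 * (u * v) * v ^ 2 ≤ (u ^ 2 + v ^ 2) * (u ^ 2 + v ^ 2) :=
    mul_le_mul b3 b4 (by positivity) (by positivity)
  nlinarith

lemma int_small : IntervalIntegrable F volume 0 (3 / 10) := by
  rw [intervalIntegrable_iff_integrableOn_Ioc_of_le (by norm_num)]
  refine ⟨?_, .restrict_of_bounded (C := 2) (by simp) ?_⟩
  · refine (continuousOn_F.mono ?_).aestronglyMeasurable measurableSet_Ioc
    exact fun x hx => hx.1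
  · refine (ae_restrict_iff' measurableSet_Ioc).2 (Filter.Eventually.of_forall ?_)
    intro x hx
    obtain ⟨h1, h2⟩ := F_small x hx.1 hx.2
    rw [Real.norm_eq_abs, abs_of_nonneg h1]
    exact h2

/-! ### Taylor approximation -/

lemma sum_exp_I (x : ℝ) (k : ℕ) :
    ∑ m ∈ Finset.range (2 * k), ((x : ℂ) * Complex.I) ^ m / (m.factorial : ℂ) =
    ((∑ j ∈ Finset.range k, (-1) ^ j * x ^ (2 * j) / ((2 * j).factorial : ℝ) : ℝ) : ℂ) +
    ((∑ j ∈ Finset.range k, (-1) ^ j * x ^ (2 * j + 1) / ((2 * j + 1).factorial : ℝ) : ℝ) : ℂ) *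
      Complex.I := by
  induction k with
  | zero => simp
  | succ k ih =>
    rw [show 2 * (k + 1) = 2 * k + 1 + 1 by ring, Finset.sum_range_succ, Finset.sum_range_succ, ih,
      Finset.sum_range_succ, Finset.sum_range_succ]
    have hI : Complex.I ^ (2 * k) = (-1) ^ k := by rw [pow_mul, Complex.I_sq]
    rw [mul_pow, mul_pow, pow_succ Complex.I, hI]
    push_cast
    ring

lemma sin_cos_approx (x : ℝ) (h0 : 0 ≤ x) (h1 : x ≤ 32 / 10) :
    |Real.sin x - ev sinL x| ≤ 1 / 10 ^ 12 ∧ |Real.cos x - ev cosL x| ≤ 1 / 10 ^ 12 := by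
  have hn : ‖(x : ℂ) * Complex.I‖ = x := by simp [abs_of_nonneg h0]
  have hb := Complex.exp_bound' (x := (x : ℂ) * Complex.I) (n := 2 * 14) (by
    rw [hn]; norm_num; linarith)
  rw [hn, sum_exp_I, Complex.exp_mul_I, ← Complex.ofReal_cos, ← Complex.ofReal_sin] at hb
  have hxx : x ^ (2 * 14) / ((2 * 14).factorial : ℝ) * 2 ≤ 1 / 10 ^ 12 := by
    have : x ^ (2 * 14) ≤ (32 / 10) ^ (2 * 14) := pow_le_pow_left₀ h0 h1 _
    norm_num [Nat.factorial] at this ⊢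
    linarith
  have hb := hb.trans hxx
  set S := ∑ j ∈ Finset.range 14, (-1) ^ j * x ^ (2 * j + 1) / ((2 * j + 1).factorial : ℝ) with hS
  set C := ∑ j ∈ Finset.range 14, (-1) ^ j * x ^ (2 * j) / ((2 * j).factorial : ℝ) with hC
  have eS : ev sinL x = S := by
    rw [hS]
    simp only [Finset.sum_range_succ, Finset.sum_range_zero, sinL, ev, Nat.factorial]
    push_cast
    ring
  have eC : ev cosL x = C := by
    rw [hC]
    simp only [Finset.sum_range_succ, Finset.sum_range_zero, cosL, ev, Nat.factorial]
    push_cast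
    ring
  rw [eS, eC]
  constructor
  · refine le_trans ?_ ((Complex.abs_im_le_norm _).trans hb)
    simp [-Complex.ofReal_sin, -Complex.ofReal_cos, -Complex.ofReal_sum]
  · refine le_trans ?_ ((Complex.abs_re_le_norm _).trans hb)
    simp [-Complex.ofReal_sin, -Complex.ofReal_cos, -Complex.ofReal_sum]

lemma exp_approx (x : ℝ) (h0 : 0 ≤ x) (h1 : x ≤ 21 / 10) :
    |Real.exp (-(1 / 10000) * x ^ 2) - ev expL x| ≤ 1 / 10 ^ 12 := by
  have hx2 : x ^ 2 ≤ (21 / 10) ^ 2 := pow_le_pow_left₀ h0 h1 _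
  have ha : |-(1 / 10000) * x ^ 2| ≤ 5 / 10000 := by
    rw [abs_le]; constructor <;> nlinarith [sq_nonneg x]
  have hb := Real.exp_bound (x := -(1 / 10000) * x ^ 2) (n := 4) (ha.trans (by norm_num))
    (by norm_num)
  have e : ev expL x = ∑ m ∈ Finset.range 4, (-(1 / 10000) * x ^ 2) ^ m / (m.factorial : ℝ) := by
    simp only [Finset.sum_range_succ, Finset.sum_range_zero, expL, ev, Nat.factorial]
    push_cast
    ring
  rw [e]
  refine hb.trans ?_
  have := pow_le_pow_left₀ (abs_nonneg _) ha 4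
  norm_num [Nat.factorial] at this ⊢
  linarith

lemma prod_approx (u v U V : ℝ) (h1 : |u - U| ≤ 1 / 10 ^ 12) (h2 : |v - V| ≤ 1 / 10 ^ 12)
    (hu : |u| ≤ 1) (hv : |v| ≤ 1) : |u * v - U * V| ≤ 3 / 10 ^ 12 := by
  have e : u * v - U * V = u * (v - V) + (u - U) * v - (u - U) * (v - V) := by ring
  have a1 : |u * (v - V)| ≤ 1 * (1 / 10 ^ 12) := by rw [abs_mul]; gcongr
  have a2 : |(u - U) * v| ≤ 1 / 10 ^ 12 * 1 := by rw [abs_mul]; gcongr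
  have a3 : |(u - U) * (v - V)| ≤ 1 / 10 ^ 12 * (1 / 10 ^ 12) := by rw [abs_mul]; gcongr
  rw [e]
  rw [abs_le] at *
  constructor <;> norm_num at a1 a2 a3 ⊢ <;> linarith [a1.1, a1.2, a2.1, a2.2, a3.1, a3.2]

lemma z1_approx (x : ℝ) (h0 : 0 ≤ x) (h1 : x ≤ 21 / 10) :
    |z₁ x - evZ ZA x / 10 ^ 30| ≤ 8 / 10 ^ 12 ∧
      |deriv z₁ x - evZ ZB x / 10 ^ 30| ≤ 8 / 10 ^ 12 := by
  have hxr : |x| ≤ ((21 / 10 : ℚ) : ℝ) := by rw [abs_of_nonneg h0]; push_cast; exact h1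
  suffices hh : |z₁ x - ev LA x| ≤ 7 / 10 ^ 12 ∧ |deriv z₁ x - ev LB x| ≤ 7 / 10 ^ 12 from
    ⟨close_of _ x (21 / 10) (by norm_num) hxr _ _ closeA hh.1,
      close_of _ x (21 / 10) (by norm_num) hxr _ _ closeB hh.2⟩
  obtain ⟨hs, hc⟩ := sin_cos_approx x h0 (by linarith)
  have he := exp_approx x h0 h1
  have he1 : |Real.exp (-(1 / 10000) * x ^ 2)| ≤ 1 := by
    rw [abs_of_pos (Real.exp_pos _), Real.exp_le_one_iff]; nlinarith [sq_nonneg x]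
  have p1 := prod_approx _ _ _ _ hs he (Real.abs_sin_le_one x) he1
  have p2 := prod_approx _ _ _ _ hc he (Real.abs_cos_le_one x) he1
  have eA : ev LA x = x - ev sinL x * ev expL x := by
    simp [LA, ev_pSub, ev_pMul, ev]
  have eB : ev LB x = 1 - ev cosL x * ev expL x +
      1 / 5000 * x * (ev sinL x * ev expL x) := by
    simp only [LB, ev_pSub, ev_pAdd, ev_pMul, ev]
    push_cast
    ring
  rw [eA, eB, deriv_z1, z₁]
  generalize Real.sin x * Real.exp (-(1 / 10000) * x ^ 2) = u at *
  generalize Real.cos x * Real.exp (-(1 / 10000) * x ^ 2) = v at *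
  generalize ev sinL x * ev expL x = U at *
  generalize ev cosL x * ev expL x = V at *
  have p3 : |1 / 5000 * x * (u - U)| ≤ 1 * (3 / 10 ^ 12) := by
    rw [abs_mul]
    refine mul_le_mul ?_ p1 (abs_nonneg _) zero_le_one
    rw [abs_le]; constructor <;> linarith
  rw [abs_le] at *
  constructor
  · constructor <;> linarith [p1.1, p1.2]
  · have e : 1 - v + 1 / 5000 * x * u - (1 - V + 1 / 5000 * x * U) =
      -(v - V) + 1 / 5000 * x * (u - U) := by ring
    rw [e, abs_le]
    constructor <;> linarith [p2.1, p2.2, p3.1, p3.2]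

lemma z2_approx1 (x : ℝ) (h0 : 0 ≤ x) (h1 : x ≤ (qe q1 : ℚ)) :
    |z₂ x - evZ ZC1 x / 10 ^ 30| ≤ 8 / 10 ^ 12 := by
  have hpi := Real.pi_gt_d20
  have hq : ((qe q1 : ℚ) : ℝ) = 1047197551196/1000000000000 := by rw [qe_real]; simp [q1]
  rw [hq] at h1
  refine close_of _ x (105 / 100) (by norm_num)
    (by rw [abs_of_nonneg h0]; push_cast; linarith) _ _ closeC ?_
  unfold z₂
  rw [if_pos (by linarith)]
  have h := (sin_cos_approx (3 * x) (by linarith) (by linarith)).1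
  have e : ev LC1 x = ev sinL (3 * x) / 3 := by
    simp only [LC1, ev_pSc, ev_scl]
    push_cast
    ring
  rw [e]
  rw [abs_le] at *
  constructor <;> linarith [h.1, h.2]

lemma z2_approx2 (x : ℝ) (h0 : ((qe q1 : ℚ) : ℝ) ≤ x) (h1 : x ≤ (qe q2 : ℚ)) :
    |z₂ x - evZ ZC2 x / 10 ^ 30| ≤ 8 / 10 ^ 12 := by
  have hpi := Real.pi_gt_d20
  have hpi2 := Real.pi_lt_d20
  have hq : ((qe q1 : ℚ) : ℝ) = 1047197551196/1000000000000 := by rw [qe_real]; simp [q1]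
  have hq2 : ((qe q2 : ℚ) : ℝ) = 1570796326794/1000000000000 := by rw [qe_real]; simp [q2]
  rw [hq] at h0
  rw [hq2] at h1
  have e : evZ ZC2 x / 10 ^ 30 = 1047197551196/1000000000000 - x := by
    simp only [ZC2, evZ]; push_cast; ring
  rw [e]
  unfold z₂
  split_ifs with g1 g2 g3
  · have s1 : Real.sin (3 * x) = Real.sin (π - 3 * x) := (Real.sin_pi_sub _).symm
    have s2 : Real.sin (π - 3 * x) ≤ π - 3 * x := Real.sin_le (by linarith)
    have s3 : 0 ≤ Real.sin (π - 3 * x) :=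
      Real.sin_nonneg_of_nonneg_of_le_pi (by linarith) (by linarith)
    rw [s1, abs_le]
    constructor <;> linarith
  · rw [abs_le]
    constructor <;> linarith
  all_goals exfalso; linarith

lemma z2_approx3 (x : ℝ) (h0 : ((qe q2 : ℚ) : ℝ) ≤ x) (h1 : x ≤ (qe q3 : ℚ)) :
    |z₂ x - evZ ZC3 x / 10 ^ 30| ≤ 8 / 10 ^ 12 := by
  have hpi := Real.pi_gt_d20
  have hpi2 := Real.pi_lt_d20
  have hq2 : ((qe q2 : ℚ) : ℝ) = 1570796326794/1000000000000 := by rw [qe_real]; simp [q2]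
  have hq3 : ((qe q3 : ℚ) : ℝ) = 2094395102394/1000000000000 := by rw [qe_real]; simp [q3]
  rw [hq2] at h0
  rw [hq3] at h1
  have e : evZ ZC3 x / 10 ^ 30 = x - 2094395102394/1000000000000 := by
    simp only [ZC3, evZ]; push_cast; ring
  rw [e]
  unfold z₂
  split_ifs with g1 g2 g3
  · exfalso; linarith
  all_goals
    rw [abs_le]
    constructor <;> linarith

theorem main : 0 < ∫ x in Set.Ioi (0 : ℝ), F x := by
  have hpi2 := Real.pi_lt_d20
  have hq1 : ((qe q1 : ℚ) : ℝ) = 1047197551196/1000000000000 := by rw [qe_real]; simp [q1]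
  have hq2 : ((qe q2 : ℚ) : ℝ) = 1570796326794/1000000000000 := by rw [qe_real]; simp [q2]
  have hq3 : ((qe q3 : ℚ) : ℝ) = 2094395102394/1000000000000 := by rw [qe_real]; simp [q3]
  have h310 : ((qe 300000000000 : ℚ) : ℝ) = 3 / 10 := by rw [qe_real]; norm_num
  have e1 : ∫ x in Set.Ioi (0 : ℝ), F x = ∫ x in (0 : ℝ)..(qe q3 : ℚ), F x := by
    rw [intervalIntegral.integral_of_le (by rw [hq3]; norm_num)]
    refine setIntegral_eq_of_subset_of_forall_sdiff_eq_zero measurableSet_Ioi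
      (fun x hx => hx.1) ?_
    intro x hx
    have hx0 : 0 < x := hx.1
    have hx1 : ((qe q3 : ℚ) : ℝ) < x := by
      by_contra hcon
      exact hx.2 ⟨hx0, not_lt.1 hcon⟩
    rw [hq3] at hx1
    have : z₂ x = 0 := by
      unfold z₂
      rw [if_neg (by linarith), if_neg (by linarith), if_neg (by linarith)]
    simp [F, this]
  have hint : ∀ u v : ℝ, 0 < u → u ≤ v → IntervalIntegrable F volume u v := by
    intro u v hu huv
    apply ContinuousOn.intervalIntegrable
    refine continuousOn_F.mono ?_
    rw [Set.uIcc_of_le huv]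
    exact fun y hy => lt_of_lt_of_le hu hy.1
  have i1 := hint (3 / 10) (qe q1 : ℚ) (by norm_num) (by rw [hq1]; norm_num)
  have i2 := hint (qe q1 : ℚ) (qe q2 : ℚ) (by rw [hq1]; norm_num) (by rw [hq1, hq2]; norm_num)
  have i3 := hint (qe q2 : ℚ) (qe q3 : ℚ) (by rw [hq2]; norm_num) (by rw [hq2, hq3]; norm_num)
  have t0 : 0 ≤ ∫ x in (0 : ℝ)..(3 / 10), F x := by
    rw [intervalIntegral.integral_of_le (by norm_num)]
    exact setIntegral_nonneg measurableSet_Ioc fun x hx => (F_small x hx.1 hx.2).1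
  have t1 := total_le ZA ZB ZC1 300000000000 cells1 run1 (by norm_num) continuousOn_F z1_pos (by
    rw [end1, h310]
    intro x hx hx'
    obtain ⟨g1, g2⟩ := z1_approx x (by linarith) (by linarith)
    exact ⟨g1, g2, z2_approx1 x (by linarith) hx'⟩)
  have t2 := total_le ZA ZB ZC2 q1 cells2 run2 (by norm_num [q1]) continuousOn_F z1_pos (by
    rw [end2]
    intro x hx hx'
    obtain ⟨g1, g2⟩ := z1_approx x (by linarith) (by linarith)
    exact ⟨g1, g2, z2_approx2 x hx hx'⟩)
  have t3 := total_le ZA ZB ZC3 q2 cells3 run3 (by norm_num [q2]) continuousOn_F z1_pos (by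
    rw [end3]
    intro x hx hx'
    obtain ⟨g1, g2⟩ := z1_approx x (by linarith) (by linarith)
    exact ⟨g1, g2, z2_approx3 x hx hx'⟩)
  rw [end1, h310] at t1
  rw [end2] at t2
  rw [end3] at t3
  have tp : (0 : ℝ) < (total 300000000000 cells1 : ℝ) + total q1 cells2 + total q2 cells3 := by
    exact_mod_cast total_pos
  rw [e1, ← intervalIntegral.integral_add_adjacent_intervals int_small (i1.trans (i2.trans i3)),
    ← intervalIntegral.integral_add_adjacent_intervals i1 (i2.trans i3),
    ← intervalIntegral.integral_add_adjacent_intervals i2 i3]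
  linarith


end FlatMuskat

/-- The computer-verified non-turning condition for the flat-at-infinity Muskat problem:
`∫_0^∞ z₁'(η) z₁(η) z₂(η) / (z₁(η)² + z₂(η)²)² dη > 0`,
which gives `A_flat > 0`, i.e. the solution remains a graph for short time. -/
theorem flat_muskat_no_turning :
    0 < ∫ η in Set.Ioi (0 : ℝ),
      deriv z₁ η * z₁ η * z₂ η / (z₁ η ^ 2 + z₂ η ^ 2) ^ 2 :=
  FlatMuskat.main
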